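/- Let ξ = exp(2πi/11), ν = (−1+i√11)/2, and for k ∈ ℤ let v_k = (ξ^k, ξ^{9k}, ξ^{3k}, ξ^{4k}, ξ^{5k}) ∈ ℂ⁵. Define the alternating form E(x,y) = Im((2/√11)·(x₁·conj(y₁) + … + x₅·conj(y₅))) on ℂ⁵. Then the ten vectors v₀, νv₀, v₁, νv₁, v₂, νv₂, v₃, νv₃, v₄, νv₄ are linearly independent over ℝ, E takes integer values on their ℤ-span Λ₀, and the determinant of the 10×10 matrix (E(b_i, b_j)) over this basis b₁,…,b₁₀ equals 11⁴. -/

import Mathlib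

/-- ξ = exp(2πi/11), a primitive 11th root of unity. -/
noncomputable def ξ : ℂ := Complex.exp (2 * Real.pi * Complex.I / 11)

/-- ν = (−1 + i√11)/2. -/
noncomputable def ν : ℂ := (-1 + Complex.I * Real.sqrt 11) / 2

/-- ℤ[ν] = {a + bν : a, b ∈ ℤ} ⊂ ℂ. -/
noncomputable def Zν : Set ℂ := {z | ∃ a b : ℤ, z = (a : ℂ) + (b : ℂ) * ν}

/-- v_k = (ξ^k, ξ^{9k}, ξ^{3k}, ξ^{4k}, ξ^{5k}) ∈ ℂ⁵. -/
noncomputable def v (k : ℕ) : Fin 5 → ℂ := fun i => ξ ^ (k * ![1, 9, 3, 4, 5] i)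

/-- The alternating form E(x,y) = Im((2/√11)·(x₁conj(y₁) + … + x₅conj(y₅))). -/
noncomputable def E (x y : Fin 5 → ℂ) : ℝ :=
  ((2 / (Real.sqrt 11 : ℂ)) * ∑ i : Fin 5, x i * (starRingEnd ℂ) (y i)).im

/-- The ten vectors v₀, νv₀, v₁, νv₁, v₂, νv₂, v₃, νv₃, v₄, νv₄. -/
noncomputable def tenBasis : Fin 10 → (Fin 5 → ℂ) :=
  ![v 0, ν • v 0, v 1, ν • v 1, v 2, ν • v 2, v 3, ν • v 3, v 4, ν • v 4]

/-- The Gram matrix of `E` in the basis `tenBasis`. -/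
def gramMatrix : Matrix (Fin 10) (Fin 10) ℤ :=
  !![0, -5, -1, 1, 1, 0, -1, 1, -1, 1;
     5, 0, 0, -3, -1, 3, 0, -3, 0, -3;
     1, 0, 0, -5, -1, 1, 1, 0, -1, 1;
     -1, 3, 5, 0, 0, -3, -1, 3, 0, -3;
     -1, 1, 1, 0, 0, -5, -1, 1, 1, 0;
     0, -3, -1, 3, 5, 0, 0, -3, -1, 3;
     1, 0, -1, 1, 1, 0, 0, -5, -1, 1;
     -1, 3, 0, -3, -1, 3, 5, 0, 0, -3;
     1, 0, 1, 0, -1, 1, 1, 0, 0, -5;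
     -1, 3, -1, 3, 0, -3, -1, 3, 5, 0]

/-- A unit lower triangular matrix such that all leading minors of `gramMatrix * colOp` are nonzero. -/
def colOp : Matrix (Fin 10) (Fin 10) ℤ :=
  !![1, 0, 0, 0, 0, 0, 0, 0, 0, 0;
     1, 1, 0, 0, 0, 0, 0, 0, 0, 0;
     0, 0, 1, 0, 0, 0, 0, 0, 0, 0;
     0, 0, -1, 1, 0, 0, 0, 0, 0, 0;
     0, 0, 0, 0, 1, 0, 0, 0, 0, 0;
     0, 1, 0, 0, 1, 1, 0, 0, 0, 0;
     0, -1, 0, 0, 0, 0, 1, 0, 0, 0;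
     0, -1, 0, 0, 0, 0, -1, 1, 0, 0;
     -1, 0, 0, 0, 0, 0, 0, 0, 1, 0;
     0, 0, 0, 0, 0, 0, 0, 0, 1, 1]

/-- The lower triangular row operations that bring `gramMatrix * colOp` to triangular form. -/
def rowOp : Matrix (Fin 10) (Fin 10) ℤ :=
  !![1, 0, 0, 0, 0, 0, 0, 0, 0, 0;
     5, 4, 0, 0, 0, 0, 0, 0, 0, 0;
     -12, -10, 1, 0, 0, 0, 0, 0, 0, 0;
     38, 32, -5, 1, 0, 0, 0, 0, 0, 0;
     -4, -3, 1, -1, 1, 0, 0, 0, 0, 0;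
     -8, -5, 5, -1, 3, 6, 0, 0, 0, 0;
     11, 0, 2, 4, -2, -4, 11, 0, 0, 0;
     -6, -1, -1, -2, 1, 2, -5, 1, 0, 0;
     -16, -10, 13, -7, -2, 7, -6, -12, 22, 0;
     14, 6, -2, 7, -2, -4, 9, 7, -8, 6]

/-- The upper triangular matrix `rowOp * (gramMatrix * colOp)`. -/
def echelon : Matrix (Fin 10) (Fin 10) ℤ :=
  !![-4, -5, -2, 1, 1, 0, -2, 1, 0, 1;
     0, -1, 2, -7, 13, 12, 2, -7, -12, -7;
     0, 0, -1, 13, -32, -29, -5, 18, 30, 19;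
     0, 0, 0, -33, 99, 88, 11, -55, -99, -66;
     0, 0, 0, 0, -12, -10, 2, 3, 13, 9;
     0, 0, 0, 0, 0, -22, 22, -11, 33, 33;
     0, 0, 0, 0, 0, 0, 11, -22, -22, 0;
     0, 0, 0, 0, 0, 0, 0, 11, 11, 0;
     0, 0, 0, 0, 0, 0, 0, 0, -11, -11;
     0, 0, 0, 0, 0, 0, 0, 0, 0, -11]

theorem rowOp_isLowerTriangular : rowOp.IsLowerTriangular := by
  have h : ∀ p : Fin 10 × Fin 10, p.1 < p.2 → rowOp p.1 p.2 = 0 := by decide +kernel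
  exact fun i j => h (i, j)

theorem colOp_isLowerTriangular : colOp.IsLowerTriangular := by
  have h : ∀ p : Fin 10 × Fin 10, p.1 < p.2 → colOp p.1 p.2 = 0 := by decide +kernel
  exact fun i j => h (i, j)

theorem echelon_isUpperTriangular : echelon.IsUpperTriangular := by
  have h : ∀ p : Fin 10 × Fin 10, p.2 < p.1 → echelon p.1 p.2 = 0 := by decide +kernel
  exact fun i j => h (i, j)

open Matrix in
theorem det_gramMatrix : gramMatrix.det = 11 ^ 4 := by
  have hmul : rowOp * (gramMatrix * colOp) = echelon := by decide +kernel
  have hC : colOp.det = 1 := by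
    rw [det_of_isLowerTriangular _ colOp_isLowerTriangular]
    decide +kernel
  have hA : rowOp.det * 11 ^ 4 = echelon.det := by
    rw [det_of_isLowerTriangular _ rowOp_isLowerTriangular,
      det_of_isUpperTriangular echelon_isUpperTriangular]
    decide +kernel
  have hA0 : rowOp.det ≠ 0 := by
    rw [det_of_isLowerTriangular _ rowOp_isLowerTriangular]
    decide +kernel
  rw [← hmul, det_mul, det_mul, hC, mul_one] at hA
  exact (mul_left_cancel₀ hA0 hA).symm

theorem xi_pow_eleven : ξ ^ 11 = 1 := by
  rw [ξ, ← Complex.exp_nat_mul, Complex.exp_eq_one_iff]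
  exact ⟨1, by push_cast; ring⟩

theorem xi_isPrimitiveRoot : IsPrimitiveRoot ξ 11 := by
  simpa [ξ] using Complex.isPrimitiveRoot_exp 11 (by norm_num)

theorem xi_cyclotomic : 1 + ξ + ξ ^ 2 + ξ ^ 3 + ξ ^ 4 + ξ ^ 5 + ξ ^ 6 + ξ ^ 7 + ξ ^ 8 + ξ ^ 9 +
    ξ ^ 10 = 0 := by
  simpa [Finset.sum_range_succ] using xi_isPrimitiveRoot.geom_sum_eq_zero (by norm_num)

theorem conj_xi : (starRingEnd ℂ) ξ = ξ ^ 10 := by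
  rw [← Complex.inv_eq_conj (Complex.norm_eq_one_of_pow_eq_one xi_pow_eleven (by norm_num))]
  exact inv_eq_of_mul_eq_one_right (by rw [← pow_succ', xi_pow_eleven])

theorem nu_sq : ν ^ 2 = -ν - 3 := by
  have h : ((Real.sqrt 11 : ℝ) : ℂ) ^ 2 = 11 := by
    norm_cast
    simp
  rw [ν]
  linear_combination (Complex.I ^ 2 / 4) * h + (11 / 4) * Complex.I_sq

theorem conj_nu : (starRingEnd ℂ) ν = -1 - ν := by
  simp only [ν, map_div₀, map_add, map_neg, map_one, map_mul, Complex.conj_I, Complex.conj_ofReal,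
    map_ofNat]
  ring

theorem nu_im : ν.im = Real.sqrt 11 / 2 := by
  simp [ν]

theorem xi_pow_im (n : ℕ) : (ξ ^ n).im = Real.sin (n * (2 * Real.pi / 11)) := by
  have h : ξ ^ n = Complex.exp (((n * (2 * Real.pi / 11) : ℝ) : ℂ) * Complex.I) := by
    rw [ξ, ← Complex.exp_nat_mul]
    congr 1
    push_cast
    ring
  rw [h, Complex.exp_ofReal_mul_I_im]

/-- The quadratic Gauss period modulo `11`. -/
theorem nu_eq_gauss_period : ν = ξ + ξ ^ 3 + ξ ^ 4 + ξ ^ 5 + ξ ^ 9 := by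
  set G := ξ + ξ ^ 3 + ξ ^ 4 + ξ ^ 5 + ξ ^ 9 with hG
  have hquad : (G - ν) * (G + 1 + ν) = 0 := by
    have hG2 : G ^ 2 + G + 3 = 0 := by
      rw [hG]
      linear_combination 3 * xi_cyclotomic + (ξ ^ 7 + 2 * ξ ^ 3 + 2 * ξ ^ 2 + 2 * ξ) *
        xi_pow_eleven
    linear_combination hG2 - nu_sq
  have hpos : 0 < G.im := by
    have hpi := Real.pi_pos
    have hsin : ∀ k : ℝ, 0 < k → k < 11 → 0 < Real.sin (k * (Real.pi / 11)) := fun k h0 h1 =>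
      Real.sin_pos_of_pos_of_lt_pi (by positivity) (by nlinarith)
    have h9 : (ξ ^ 9).im = -Real.sin (4 * (Real.pi / 11)) := by
      rw [xi_pow_im, ← Real.sin_neg, ← Real.sin_sub_two_pi]
      congr 1
      push_cast
      ring
    have h3 : (ξ ^ 3).im = Real.sin (5 * (Real.pi / 11)) := by
      rw [xi_pow_im, ← Real.sin_pi_sub]
      congr 1
      push_cast
      ring
    have hlt : Real.sin (4 * (Real.pi / 11)) < Real.sin (5 * (Real.pi / 11)) :=
      Real.sin_lt_sin_of_lt_of_le_pi_div_two (by linarith) (by linarith) (by linarith)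
    have h1 : 0 < ξ.im := by
      have := xi_pow_im 1
      rw [pow_one] at this
      rw [this]
      convert hsin 2 (by norm_num) (by norm_num) using 2
      push_cast
      ring
    have h4 : 0 < (ξ ^ 4).im := by
      rw [xi_pow_im]
      convert hsin 8 (by norm_num) (by norm_num) using 2
      push_cast
      ring
    have h5 : 0 < (ξ ^ 5).im := by
      rw [xi_pow_im]
      convert hsin 10 (by norm_num) (by norm_num) using 2
      push_cast
      ring
    simp only [hG, Complex.add_im, h9, h3]
    linarith
  rcases mul_eq_zero.1 hquad with h | h
  · exact (sub_eq_zero.1 h).symm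
  · have him := congrArg Complex.im h
    simp only [Complex.add_im, Complex.one_im, Complex.zero_im, nu_im] at him
    have := Real.sqrt_nonneg 11
    linarith

/-- The rational part and the coefficient of `ν` of `∑ i, ξ ^ (d * a i)`, `a = (1, 9, 3, 4, 5)`. -/
def period : ℕ → ℤ × ℤ
  | 0 => (5, 0)
  | 1 | 3 | 4 | 5 | 9 => (0, 1)
  | _ => (-1, -1)

theorem sum_xi_pow (d : ℕ) : ∑ i : Fin 5, ξ ^ (d * ![1, 9, 3, 4, 5] i) =
    (period (d % 11)).1 + (period (d % 11)).2 * ν := by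
  have hmod : ∀ i, ξ ^ (d * ![1, 9, 3, 4, 5] i) = ξ ^ (d % 11 * ![1, 9, 3, 4, 5] i % 11) :=
    fun i => by rw [pow_eq_pow_mod _ xi_pow_eleven, Nat.mod_mul_mod]
  have hlt : d % 11 < 11 := Nat.mod_lt _ (by norm_num)
  simp only [hmod]
  generalize d % 11 = r at hlt
  have hν := nu_eq_gauss_period
  have hcyc := xi_cyclotomic
  interval_cases r <;> simp [Fin.sum_univ_five, period] <;>
    first
    | linear_combination -hν
    | linear_combination hcyc + hν

theorem sum_v_mul_conj_v (j k : ℕ) : ∑ i, v j i * (starRingEnd ℂ) (v k i) =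
    (period ((j + 10 * k) % 11)).1 + (period ((j + 10 * k) % 11)).2 * ν := by
  rw [← sum_xi_pow]
  refine Finset.sum_congr rfl fun i _ => ?_
  rw [v, v, map_pow, conj_xi, ← pow_mul, ← pow_add]
  congr 1
  ring

theorem im_two_div_sqrt_mul (a b : ℤ) :
    ((2 / (Real.sqrt 11 : ℂ)) * (a + b * ν)).im = b := by
  have h : (2 / (Real.sqrt 11 : ℂ)) = ((2 / Real.sqrt 11 : ℝ) : ℂ) := by push_cast; rfl
  have h0 : Real.sqrt 11 ≠ 0 := by positivity
  rw [h, Complex.im_ofReal_mul]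
  simp only [Complex.add_im, Complex.intCast_im, Complex.mul_im, Complex.intCast_re, nu_im]
  field_simp
  ring

theorem E_v_v (j k : ℕ) : E (v j) (v k) = (period ((j + 10 * k) % 11)).2 := by
  rw [E, sum_v_mul_conj_v, im_two_div_sqrt_mul]

theorem sum_smul_mul_conj_smul (a b : ℂ) (x y : Fin 5 → ℂ) :
    ∑ i, (a • x) i * (starRingEnd ℂ) ((b • y) i) =
      a * (starRingEnd ℂ) b * ∑ i, x i * (starRingEnd ℂ) (y i) := by
  rw [Finset.mul_sum]
  refine Finset.sum_congr rfl fun i _ => ?_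
  simp only [Pi.smul_apply, smul_eq_mul, map_mul]
  ring

theorem E_nu_v_v (j k : ℕ) : E (ν • v j) (v k) =
    ((period ((j + 10 * k) % 11)).1 - (period ((j + 10 * k) % 11)).2 : ℤ) := by
  rw [E, ← one_smul ℂ (v k), sum_smul_mul_conj_smul, sum_v_mul_conj_v, map_one,
    ← im_two_div_sqrt_mul (-3 * (period ((j + 10 * k) % 11)).2)]
  congr 2
  push_cast
  linear_combination ((period ((j + 10 * k) % 11)).2 : ℂ) * nu_sq

theorem E_v_nu_v (j k : ℕ) : E (v j) (ν • v k) = (-(period ((j + 10 * k) % 11)).1 : ℤ) := by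
  rw [E, ← one_smul ℂ (v j), sum_smul_mul_conj_smul, sum_v_mul_conj_v, conj_nu,
    ← im_two_div_sqrt_mul
      (3 * (period ((j + 10 * k) % 11)).2 - (period ((j + 10 * k) % 11)).1)]
  congr 2
  push_cast
  linear_combination -((period ((j + 10 * k) % 11)).2 : ℂ) * nu_sq

theorem E_nu_v_nu_v (j k : ℕ) : E (ν • v j) (ν • v k) =
    (3 * (period ((j + 10 * k) % 11)).2 : ℤ) := by
  rw [E, sum_smul_mul_conj_smul, sum_v_mul_conj_v, conj_nu,
    ← im_two_div_sqrt_mul (3 * (period ((j + 10 * k) % 11)).1)]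
  congr 2
  push_cast
  linear_combination -((period ((j + 10 * k) % 11)).1 +
    (period ((j + 10 * k) % 11)).2 * ν : ℂ) * nu_sq

theorem E_tenBasis (i j : Fin 10) : E (tenBasis i) (tenBasis j) = gramMatrix i j := by
  fin_cases i <;> fin_cases j <;>
    simp [tenBasis, gramMatrix, E_v_v, E_nu_v_v, E_v_nu_v, E_nu_v_nu_v, period]

theorem E_add_left (x x' y : Fin 5 → ℂ) : E (x + x') y = E x y + E x' y := by
  simp only [E, Pi.add_apply, add_mul, Finset.sum_add_distrib, mul_add, Complex.add_im]

theorem E_add_right (x y y' : Fin 5 → ℂ) : E x (y + y') = E x y + E x y' := by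
  simp only [E, Pi.add_apply, map_add, Finset.sum_add_distrib, mul_add, Complex.add_im]

theorem E_smul_left (c : ℝ) (x y : Fin 5 → ℂ) : E (c • x) y = c * E x y := by
  rw [E, E, ← Complex.im_ofReal_mul, mul_left_comm, Finset.mul_sum (a := (c : ℂ))]
  simp only [Pi.smul_apply, Complex.real_smul, mul_assoc]

/-- `E` as an `ℝ`-linear form in its first argument. -/
noncomputable def linearE (y : Fin 5 → ℂ) : (Fin 5 → ℂ) →ₗ[ℝ] ℝ where
  toFun x := E x y
  map_add' x x' := E_add_left x x' y
  map_smul' c x := E_smul_left c x y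

/-- `E` as an additive map in its second argument. -/
noncomputable def addE (x : Fin 5 → ℂ) : (Fin 5 → ℂ) →+ ℝ :=
  AddMonoidHom.mk' (E x) (E_add_right x)

theorem E_mem_of_mem_closure {S T : Set (Fin 5 → ℂ)} {R : AddSubgroup ℝ}
    (h : ∀ x ∈ S, ∀ y ∈ T, E x y ∈ R) {x y : Fin 5 → ℂ}
    (hx : x ∈ AddSubgroup.closure S) (hy : y ∈ AddSubgroup.closure T) : E x y ∈ R := by
  have hleft : ∀ y ∈ T, E x y ∈ R := fun y hy =>
    (AddSubgroup.closure_le (R.comap (linearE y).toAddMonoidHom)).2 (fun x hx => h x hx y hy) hx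
  exact (AddSubgroup.closure_le (R.comap (addE x))).2 hleft hy

theorem det_E_tenBasis :
    (Matrix.of fun i j : Fin 10 => E (tenBasis i) (tenBasis j)).det = 11 ^ 4 := by
  have h : (Matrix.of fun i j : Fin 10 => E (tenBasis i) (tenBasis j)) =
      gramMatrix.map (Int.castRingHom ℝ) := by
    ext i j
    simp [E_tenBasis]
  rw [h, ← RingHom.mapMatrix_apply, ← RingHom.map_det, det_gramMatrix]
  norm_num

theorem linearIndependent_tenBasis : LinearIndependent ℝ tenBasis := by
  rw [Fintype.linearIndependent_iff]
  intro c hc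
  have hdet : (Matrix.of fun i j : Fin 10 => E (tenBasis i) (tenBasis j)).det ≠ 0 := by
    rw [det_E_tenBasis]
    norm_num
  refine congrFun (Matrix.eq_zero_of_vecMul_eq_zero hdet ?_)
  ext j
  simpa [Matrix.vecMul, dotProduct, linearE] using (congrArg (linearE (tenBasis j)) hc).trans (map_zero _)

/-- the ten vectors v₀, νv₀, …, v₄, νv₄ are ℝ-linearly independent, E takes
integer values on their ℤ-span Λ₀, and the determinant of the 10×10 matrix (E(b_i,b_j)) over
this basis equals 11⁴. -/
theorem pfaffian_squared_Lambda0 :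
    LinearIndependent ℝ tenBasis ∧
    (∀ x ∈ AddSubgroup.closure (Set.range tenBasis),
      ∀ y ∈ AddSubgroup.closure (Set.range tenBasis), ∃ n : ℤ, E x y = n) ∧
    (Matrix.of fun i j : Fin 10 => E (tenBasis i) (tenBasis j)).det = 11 ^ 4 := by
  refine ⟨linearIndependent_tenBasis, fun x hx y hy => ?_, det_E_tenBasis⟩
  obtain ⟨n, hn⟩ := E_mem_of_mem_closure (R := (Int.castAddHom ℝ).range) (by
    rintro _ ⟨i, rfl⟩ _ ⟨j, rfl⟩
    exact ⟨gramMatrix i j, (E_tenBasis i j).symm⟩) hx hy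
  exact ⟨n, hn.symm⟩
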